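/- Let G be a finite connected graph on n ≥ 2 nodes with positive edge weights and PTDF matrix V = B C L⁺, and suppose the orientation of the edges is chosen so that V e₁ ≥ 0 componentwise. Let λ ∈ (0, 1). Then the unique minimizer of g ↦ (1/2)‖g‖² over {g ∈ ℝⁿ : eᵀ g = 1 and −λ V e₁ ≤ V(g − e₁) ≤ λ V e₁ componentwise} is g(λ) = (λ/n) e + (1 − λ) e₁; that is, g(λ)₁ = 1 − λ(n − 1)/n and g(λ)_i = λ/n for all i = 2, …, n. Moreover the corresponding line flows are at capacity: V(g(λ) − e₁) = −λ V e₁. -/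

import Mathlib

open Matrix

/-- Every row of `C` is the signed indicator `δ_i - δ_j` of an oriented edge `(i, j)`. -/
def IsOrientedIncidence {n m : ℕ} (C : Matrix (Fin m) (Fin n) ℝ) : Prop :=
  ∀ ℓ : Fin m, ∃ i j : Fin n, i ≠ j ∧ C ℓ i = 1 ∧ C ℓ j = -1 ∧
    ∀ k : Fin n, k ≠ i → k ≠ j → C ℓ k = 0

namespace IsOrientedIncidence

variable {n m : ℕ} {C : Matrix (Fin m) (Fin n) ℝ}

lemma exists_mulVec_eq (hC : IsOrientedIncidence C) (ℓ : Fin m) :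
    ∃ i j : Fin n, i ≠ j ∧ C ℓ i = 1 ∧ C ℓ j = -1 ∧ (∀ k, k ≠ i → k ≠ j → C ℓ k = 0) ∧
      ∀ z : Fin n → ℝ, (C *ᵥ z) ℓ = z i - z j := by
  obtain ⟨i, j, hij, hi, hj, h0⟩ := hC ℓ
  refine ⟨i, j, hij, hi, hj, h0, fun z => ?_⟩
  rw [mulVec, dotProduct,
    Finset.sum_eq_add i j hij (fun k _ hk => by rw [h0 k hk.1 hk.2, zero_mul]) (by simp) (by simp),
    hi, hj]
  ring

lemma mulVec_const (hC : IsOrientedIncidence C) (c : ℝ) : C *ᵥ (fun _ => c) = 0 := by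
  ext ℓ
  obtain ⟨i, j, -, -, -, -, h⟩ := hC.exists_mulVec_eq ℓ
  simp [h]

lemma eq_of_mulVec_eq_zero (hC : IsOrientedIncidence C)
    (hconn : (SimpleGraph.fromRel
      (fun i j : Fin n => ∃ ℓ : Fin m, C ℓ i ≠ 0 ∧ C ℓ j ≠ 0)).Connected)
    {z : Fin n → ℝ} (hz : C *ᵥ z = 0) (a b : Fin n) : z a = z b := by
  have key : ∀ ℓ a b, C ℓ a ≠ 0 → C ℓ b ≠ 0 → z a = z b := by
    intro ℓ a b ha hb
    obtain ⟨i, j, -, -, -, h0, h⟩ := hC.exists_mulVec_eq ℓ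
    have hij : z i = z j := by
      have := h z
      rw [hz, Pi.zero_apply] at this
      linarith
    have hmem : ∀ k, C ℓ k ≠ 0 → z k = z i := by
      intro k hk
      by_cases hki : k = i
      · rw [hki]
      by_cases hkj : k = j
      · rw [hkj, hij]
      exact absurd (h0 k hki hkj) hk
    rw [hmem a ha, hmem b hb]
  obtain ⟨w⟩ := hconn.preconnected a b
  induction w with
  | nil => rfl
  | cons hadj _ ih =>
    rw [← ih]
    rw [SimpleGraph.fromRel_adj] at hadj
    rcases hadj.2 with ⟨ℓ, h1, h2⟩ | ⟨ℓ, h1, h2⟩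
    · exact key ℓ _ _ h1 h2
    · exact key ℓ _ _ h2 h1

end IsOrientedIncidence

section WeightedLaplacian

variable {n m : ℕ} {C : Matrix (Fin m) (Fin n) ℝ} {β : Fin m → ℝ}

lemma weightedLaplacian_mulVec_apply (z : Fin n → ℝ) (k : Fin n) :
    ((Cᵀ * diagonal β * C) *ᵥ z) k = ∑ ℓ, C ℓ k * (β ℓ * (C *ᵥ z) ℓ) := by
  rw [← mulVec_mulVec, ← mulVec_mulVec, mulVec, dotProduct]
  simp only [transpose_apply, mulVec_diagonal]

lemma weightedLaplacian_transpose :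
    (Cᵀ * diagonal β * C)ᵀ = Cᵀ * diagonal β * C := by
  simp [Matrix.transpose_mul, Matrix.mul_assoc]

lemma mulVec_eq_zero_of_weightedLaplacian (hβ : ∀ ℓ, 0 < β ℓ) {z : Fin n → ℝ}
    (hz : (Cᵀ * diagonal β * C) *ᵥ z = 0) : C *ᵥ z = 0 := by
  have h : ∑ ℓ, β ℓ * (C *ᵥ z) ℓ ^ 2 = 0 := by
    have h1 : z ⬝ᵥ ((Cᵀ * diagonal β * C) *ᵥ z) = 0 := by rw [hz, dotProduct_zero]
    rw [← h1, ← mulVec_mulVec, ← mulVec_mulVec, dotProduct_mulVec, vecMul_transpose, dotProduct]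
    refine Finset.sum_congr rfl fun ℓ _ => ?_
    rw [mulVec_diagonal]
    ring
  rw [Finset.sum_eq_zero_iff_of_nonneg (fun ℓ _ => mul_nonneg (hβ ℓ).le (sq_nonneg _))] at h
  ext ℓ
  simpa [(hβ ℓ).ne'] using h ℓ (Finset.mem_univ ℓ)

/-- The weighted Laplacian applied to `z` is nonnegative at a maximum of `z`. -/
lemma weightedLaplacian_mulVec_nonneg_of_max (hC : IsOrientedIncidence C) (hβ : ∀ ℓ, 0 < β ℓ)
    {z : Fin n → ℝ} {k : Fin n} (hk : ∀ i, z i ≤ z k) :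
    0 ≤ ((Cᵀ * diagonal β * C) *ᵥ z) k := by
  rw [weightedLaplacian_mulVec_apply]
  refine Finset.sum_nonneg fun ℓ _ => ?_
  obtain ⟨i, j, -, hi, hj, h0, h⟩ := hC.exists_mulVec_eq ℓ
  rw [h]
  by_cases hki : k = i
  · subst hki
    rw [hi, one_mul]
    exact mul_nonneg (hβ ℓ).le (sub_nonneg.2 (hk j))
  by_cases hkj : k = j
  · subst hkj
    rw [hj]
    nlinarith [hβ ℓ, hk i]
  rw [h0 k hki hkj, zero_mul]

variable {M : Matrix (Fin n) (Fin n) ℝ}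

lemma weightedLaplacian_mul_mulVec_const (hC : IsOrientedIncidence C)
    (hsymm : ((Cᵀ * diagonal β * C) * M)ᵀ = (Cᵀ * diagonal β * C) * M) (c : ℝ) :
    ((Cᵀ * diagonal β * C) * M) *ᵥ (fun _ => c) = 0 := by
  rw [← hsymm, transpose_mul, weightedLaplacian_transpose, ← mulVec_mulVec, ← mulVec_mulVec,
    hC.mulVec_const, mulVec_zero, mulVec_zero]

/-- `L L⁺` is the orthogonal projection onto the vectors of mean zero. -/
lemma weightedLaplacian_mul_mulVec_apply (hC : IsOrientedIncidence C)
    (hconn : (SimpleGraph.fromRel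
      (fun i j : Fin n => ∃ ℓ : Fin m, C ℓ i ≠ 0 ∧ C ℓ j ≠ 0)).Connected)
    (hβ : ∀ ℓ, 0 < β ℓ)
    (hinv : (Cᵀ * diagonal β * C) * M * (Cᵀ * diagonal β * C) = Cᵀ * diagonal β * C)
    (hsymm : ((Cᵀ * diagonal β * C) * M)ᵀ = (Cᵀ * diagonal β * C) * M)
    (y : Fin n → ℝ) (k : Fin n) :
    (((Cᵀ * diagonal β * C) * M) *ᵥ y) k = y k - (∑ i, y i) / n := by
  have hconst := weightedLaplacian_mul_mulVec_const hC hsymm 1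
  have hker : (Cᵀ * diagonal β * C) *ᵥ (y - ((Cᵀ * diagonal β * C) * M) *ᵥ y) = 0 := by
    have h : (Cᵀ * diagonal β * C) * ((Cᵀ * diagonal β * C) * M) = Cᵀ * diagonal β * C := by
      have := congrArg transpose hinv
      rwa [transpose_mul, hsymm, weightedLaplacian_transpose] at this
    rw [mulVec_sub, mulVec_mulVec, h, sub_self]
  have heq := fun i =>
    hC.eq_of_mulVec_eq_zero hconn (mulVec_eq_zero_of_weightedLaplacian hβ hker) i k
  have hsum : ∑ i, (((Cᵀ * diagonal β * C) * M) *ᵥ y) i = 0 := by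
    have : (fun _ => (1 : ℝ)) ⬝ᵥ (((Cᵀ * diagonal β * C) * M) *ᵥ y) = 0 := by
      rw [dotProduct_mulVec, ← mulVec_transpose, hsymm, hconst, zero_dotProduct]
    simpa [dotProduct] using this
  have htot := Finset.sum_congr (rfl : (Finset.univ : Finset (Fin n)) = _) fun i _ => heq i
  simp only [Pi.sub_apply, Finset.sum_sub_distrib, Finset.sum_const, Finset.card_univ,
    Fintype.card_fin, nsmul_eq_mul] at htot
  have hn : (n : ℝ) ≠ 0 := by
    have := k.pos
    positivity
  rw [hsum, sub_zero] at htot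
  rw [htot]
  field_simp
  ring

/-- An edge along which the flow caused by a unit injection at `v` is nonnegative is not oriented
towards `v`. -/
lemma incidence_nonneg_of_flow_nonneg (hC : IsOrientedIncidence C)
    (hβ : ∀ ℓ, 0 < β ℓ) {z : Fin n → ℝ} {v : Fin n}
    (hz : ∀ k, k ≠ v → ((Cᵀ * diagonal β * C) *ᵥ z) k < 0) {ℓ : Fin m}
    (hflow : 0 ≤ (C *ᵥ z) ℓ) : 0 ≤ C ℓ v := by
  have hmax : ∀ k, (∀ i, z i ≤ z k) → k = v := fun k hk => by
    by_contra hkv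
    exact absurd (weightedLaplacian_mulVec_nonneg_of_max hC hβ hk) (hz k hkv).not_ge
  have : Nonempty (Fin n) := ⟨v⟩
  obtain ⟨k, hk⟩ := Finite.exists_max z
  obtain rfl := hmax k hk
  obtain ⟨i, j, hij, hi, hj, h0, h⟩ := hC.exists_mulVec_eq ℓ
  by_cases hki : k = i
  · rw [hki, hi]
    exact zero_le_one
  by_cases hkj : k = j
  · rw [h, ← hkj] at hflow
    exact absurd (hmax i fun a => (hk a).trans (by linarith)).symm hki
  exact (h0 k hki hkj).ge

end WeightedLaplacian

/-- With demand `d = e₁` (unit demand at node 1, zero elsewhere) and the orientation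
chosen so that `V e₁ ≥ 0` componentwise, the unique minimizer of `g ↦ (1/2)‖g‖²` over
`{g : eᵀ g = 1, -λ V e₁ ≤ V(g - e₁) ≤ λ V e₁}` is `g(λ) = (λ/n) e + (1-λ) e₁`, i.e.
`g(λ)₁ = 1 - λ(n-1)/n` and `g(λ)ᵢ = λ/n` for `i ≠ 1`; moreover the corresponding line
flows are at capacity: `V(g(λ) - e₁) = -λ V e₁`. -/
theorem stmt_11
    (n m : ℕ) (hn : 2 ≤ n)
    (C : Matrix (Fin m) (Fin n) ℝ)
    (hC : ∀ ℓ : Fin m, ∃ i j : Fin n, i ≠ j ∧ C ℓ i = 1 ∧ C ℓ j = -1 ∧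
      ∀ k : Fin n, k ≠ i → k ≠ j → C ℓ k = 0)
    (hconn : (SimpleGraph.fromRel
      (fun i j : Fin n => ∃ ℓ : Fin m, C ℓ i ≠ 0 ∧ C ℓ j ≠ 0)).Connected)
    (β : Fin m → ℝ) (hβ : ∀ ℓ, 0 < β ℓ)
    (L : Matrix (Fin n) (Fin n) ℝ)
    (hL : L = Cᵀ * Matrix.diagonal β * C)
    (Lplus : Matrix (Fin n) (Fin n) ℝ)
    (hMP : L * Lplus * L = L ∧ Lplus * L * Lplus = Lplus ∧
      (L * Lplus)ᵀ = L * Lplus ∧ (Lplus * L)ᵀ = Lplus * L)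
    (V : Matrix (Fin m) (Fin n) ℝ)
    (hV : V = Matrix.diagonal β * C * Lplus)
    (e1 : Fin n → ℝ)
    (he1 : e1 = fun i => if i = (⟨0, by omega⟩ : Fin n) then (1 : ℝ) else 0)
    (horient : ∀ ℓ : Fin m, 0 ≤ (V *ᵥ e1) ℓ)
    (lam : ℝ) (hlam : lam ∈ Set.Ioo (0 : ℝ) 1)
    (gl : Fin n → ℝ)
    (hgl : gl = fun i => lam / n + (1 - lam) * e1 i) :
    (gl (⟨0, by omega⟩ : Fin n) = 1 - lam * (n - 1) / n) ∧
    (∀ i : Fin n, i ≠ (⟨0, by omega⟩ : Fin n) → gl i = lam / n) ∧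
    (V *ᵥ (gl - e1) = -(lam • (V *ᵥ e1))) ∧
    ((∑ i, gl i = 1) ∧
      ∀ ℓ : Fin m, -(lam * (V *ᵥ e1) ℓ) ≤ (V *ᵥ (gl - e1)) ℓ ∧
        (V *ᵥ (gl - e1)) ℓ ≤ lam * (V *ᵥ e1) ℓ) ∧
    (∀ g : Fin n → ℝ,
      ((∑ i, g i = 1) ∧
        ∀ ℓ : Fin m, -(lam * (V *ᵥ e1) ℓ) ≤ (V *ᵥ (g - e1)) ℓ ∧
          (V *ᵥ (g - e1)) ℓ ≤ lam * (V *ᵥ e1) ℓ) →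
      ((1 / 2 : ℝ) * ∑ i, (gl i) ^ 2 ≤ (1 / 2 : ℝ) * ∑ i, (g i) ^ 2 ∧
        (g ≠ gl → (1 / 2 : ℝ) * ∑ i, (gl i) ^ 2 < (1 / 2 : ℝ) * ∑ i, (g i) ^ 2))) := by
  subst hL
  obtain ⟨hinv, hinv', hsymm, -⟩ := hMP
  obtain ⟨hlam0, hlam1⟩ := hlam
  replace hC : IsOrientedIncidence C := hC
  set v : Fin n := ⟨0, by omega⟩
  have hnpos : (0 : ℝ) < n := by
    have : 0 < n := by omega
    exact_mod_cast this
  have he1v : e1 v = 1 := by rw [he1]; simp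
  have he1ne : ∀ i, i ≠ v → e1 i = 0 := fun i hi => by rw [he1]; simp [hi]
  have he1sum : ∑ i, e1 i = 1 := by rw [he1]; simp
  have hVapp : ∀ (x : Fin n → ℝ) ℓ, (V *ᵥ x) ℓ = β ℓ * (C *ᵥ (Lplus *ᵥ x)) ℓ := fun x ℓ => by
    rw [hV, ← mulVec_mulVec, ← mulVec_mulVec, mulVec_diagonal]
  have hVconst : ∀ c : ℝ, V *ᵥ (fun _ => c) = 0 := fun c => by
    rw [hV, ← hinv', Matrix.mul_assoc Lplus, ← mulVec_mulVec,
      ← mulVec_mulVec _ Lplus, weightedLaplacian_mul_mulVec_const hC hsymm, mulVec_zero, mulVec_zero]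
  have hflow : V *ᵥ (gl - e1) = -(lam • (V *ᵥ e1)) := by
    have : gl - e1 = (fun _ => lam / n) - lam • e1 := by
      ext i
      simp only [hgl, Pi.sub_apply, Pi.smul_apply, smul_eq_mul]
      ring
    rw [this, mulVec_sub, hVconst, mulVec_smul, zero_sub]
  have hflow' : ∀ ℓ, (V *ᵥ (gl - e1)) ℓ = -(lam * (V *ᵥ e1) ℓ) := fun ℓ => by
    rw [hflow]; rfl
  have hglsum : ∑ i, gl i = 1 := by
    rw [hgl, Finset.sum_add_distrib, ← Finset.mul_sum, he1sum]
    simp only [Finset.sum_const, Finset.card_univ, Fintype.card_fin, nsmul_eq_mul]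
    field_simp
    ring
  have hCv : ∀ ℓ, 0 ≤ C ℓ v := fun ℓ => by
    refine incidence_nonneg_of_flow_nonneg (z := Lplus *ᵥ e1) hC hβ (fun k hk => ?_)
      (nonneg_of_mul_nonneg_right ?_ (hβ ℓ))
    · rw [mulVec_mulVec, weightedLaplacian_mul_mulVec_apply hC hconn hβ hinv hsymm, he1sum,
        he1ne k hk, zero_sub]
      exact neg_lt_zero.2 (by positivity)
    · rw [← hVapp]
      exact horient ℓ
  refine ⟨?_, ?_, hflow, ⟨hglsum, fun ℓ => ?_⟩, ?_⟩
  · rw [hgl]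
    simp only [he1v]
    field_simp
    ring
  · intro i hi
    rw [hgl]
    simp [he1ne i hi]
  · rw [hflow' ℓ]
    have := mul_nonneg hlam0.le (horient ℓ)
    exact ⟨le_rfl, by linarith⟩
  rintro g ⟨hgsum, hg⟩
  have hxsum : ∑ i, (g - gl) i = 0 := by
    simp [Finset.sum_sub_distrib, hgsum, hglsum]
  have hVx : ∀ ℓ, 0 ≤ (V *ᵥ (g - gl)) ℓ := fun ℓ => by
    have h : g - gl = (g - e1) - (gl - e1) := by abel
    rw [h, mulVec_sub, Pi.sub_apply, hflow']
    linarith [(hg ℓ).1]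
  have hxv : 0 ≤ (g - gl) v := by
    have h := weightedLaplacian_mul_mulVec_apply hC hconn hβ hinv hsymm (g - gl) v
    rw [hxsum, zero_div, sub_zero, ← mulVec_mulVec, weightedLaplacian_mulVec_apply] at h
    rw [← h]
    refine Finset.sum_nonneg fun ℓ _ => mul_nonneg (hCv ℓ) ?_
    rw [← hVapp]
    exact hVx ℓ
  have hexp : ∑ i, g i ^ 2 =
      ∑ i, gl i ^ 2 + 2 * (1 - lam) * (g - gl) v + ∑ i, (g - gl) i ^ 2 := by
    have hin : ∑ i, (1 - lam) * e1 i * (g - gl) i = (1 - lam) * (g - gl) v := by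
      rw [Finset.sum_eq_single v (fun i _ hi => by rw [he1ne i hi]; ring) (by simp), he1v, mul_one]
    have hcst : ∑ i, lam / n * (g - gl) i = 0 := by rw [← Finset.mul_sum, hxsum, mul_zero]
    have hpt : ∀ i, g i ^ 2 = gl i ^ 2 +
        2 * (lam / n * (g - gl) i + (1 - lam) * e1 i * (g - gl) i) + (g - gl) i ^ 2 := fun i => by
      have : gl i = lam / n + (1 - lam) * e1 i := by rw [hgl]
      rw [← add_mul, ← this, Pi.sub_apply]
      ring
    rw [Finset.sum_congr rfl fun i _ => hpt i, Finset.sum_add_distrib, Finset.sum_add_distrib,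
      ← Finset.mul_sum, Finset.sum_add_distrib, hin, hcst]
    ring
  have hcross : 0 ≤ 2 * (1 - lam) * (g - gl) v := mul_nonneg (by linarith) hxv
  refine ⟨?_, fun hne => ?_⟩
  · have : 0 ≤ ∑ i, (g - gl) i ^ 2 := Finset.sum_nonneg fun i _ => sq_nonneg _
    linarith
  · have : 0 < ∑ i, (g - gl) i ^ 2 := by
      obtain ⟨i, hi⟩ := Function.ne_iff.1 (sub_ne_zero.2 hne)
      exact Finset.sum_pos' (fun i _ => sq_nonneg _)
        ⟨i, Finset.mem_univ i, (sq_nonneg _).lt_of_ne' (pow_ne_zero 2 hi)⟩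
    linarith
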